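/- Let 𝔄 be a subshift, G* a discrete abelian group, c* a local rule of radius r* on 𝔄 valued in G*, Φ a cellular automaton of radius R with Φ(𝔄) ⊆ 𝔄, and φ a group endomorphism of G* (note that φ∘c* is again a local rule of radius r*). Suppose that for some ρ ≥ r* + R, the lifts of the pullback Φ_*c* and of φ∘c* to radius ρ are locally cohomologous. Then: (i) for every a ∈ A^(ℤ^D) and every closed trail ζ lying in G_ρ(a), c*(ζ, Φ(a)) = φ( c*(ζ, a) ); (ii) if φ is injective and a ∈ 𝔄̃ has a projective c*-pole, then Φ(a) has a projective c*-pole; consequently every configuration in 𝔄̃ with a projective c*-pole has a Φ-persistent defect. -/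

import Mathlib

open scoped ENNReal

namespace Defects

/-- The configuration space `A^(ℤ^D)`. -/
abbrev Config (D : ℕ) (A : Type) := (Fin D → ℤ) → A

variable {D : ℕ} {A : Type}

/-- The shift `σ^v`. -/
def shift (v : Fin D → ℤ) (a : Config D A) : Config D A := fun z => a (z + v)

/-- A subshift: a nonempty closed shift-invariant subset of `A^(ℤ^D)`. -/
def IsSubshift [TopologicalSpace A] (𝔄 : Set (Config D A)) : Prop :=
  𝔄.Nonempty ∧ IsClosed 𝔄 ∧ ∀ v : Fin D → ℤ, shift v '' 𝔄 = 𝔄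

/-- The cube `B(r) = [-r, r]^D ⊆ ℤ^D`. -/
def ballZ (D r : ℕ) : Set (Fin D → ℤ) := {w | ∀ i, |w i| ≤ (r : ℤ)}

/-- The `r`-block of `a` at `z`, as an element of `A^(B(r))`. -/
def blockAt (r : ℕ) (a : Config D A) (z : Fin D → ℤ) : ballZ D r → A :=
  fun w => a (z + w.1)

/-- The set `𝔄_(r)` of admissible `r`-blocks. -/
def admissibleBlocks (𝔄 : Set (Config D A)) (r : ℕ) : Set (ballZ D r → A) :=
  (fun a => blockAt r a 0) '' 𝔄

/-- `G_R(a)`: the set of `z` where the `R`-block of `a` is admissible. -/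
def goodSet (𝔄 : Set (Config D A)) (R : ℕ) (a : Config D A) : Set (Fin D → ℤ) :=
  {z | blockAt R a z ∈ admissibleBlocks 𝔄 R}

/-- `𝔄̃`: configurations having arbitrarily large admissible regions. -/
def almostAdmissible (𝔄 : Set (Config D A)) : Set (Config D A) :=
  {a | ∀ R : ℕ, (goodSet 𝔄 R a).Nonempty}

/-- The defect of `a` is removable if some `a' ∈ 𝔄` agrees with `a` on `G_r(a)`. -/
def Removable (𝔄 : Set (Config D A)) (a : Config D A) : Prop :=
  ∃ r : ℕ, ∃ a' ∈ 𝔄, ∀ z ∈ goodSet 𝔄 r a, a' z = a z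

/-- A cellular automaton: continuous and commuting with all shifts. -/
def IsCellularAutomaton [TopologicalSpace A] (Φ : Config D A → Config D A) : Prop :=
  Continuous Φ ∧ ∀ v : Fin D → ℤ, Φ ∘ shift v = shift v ∘ Φ

/-- `Φ` has radius `R`: `Φ(a)(z)` depends only on the `R`-block of `a` at `z`. -/
def HasRadius {B : Type} (Φ : Config D A → Config D B) (R : ℕ) : Prop :=
  ∀ a b : Config D A, ∀ z : Fin D → ℤ, blockAt R a z = blockAt R b z → Φ a z = Φ b z

/-- `E = {±e_1, …, ±e_D}`. -/
def stdSteps (D : ℕ) : Set (Fin D → ℤ) :=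
  {v | ∃ i : Fin D, v = Pi.single i 1 ∨ v = -Pi.single i 1}

/-- A subshift homomorphism `Φ : 𝔄 → 𝔅`. -/
def IsSubshiftHom {B : Type} [TopologicalSpace A] [TopologicalSpace B]
    (𝔄 : Set (Config D A)) (𝔅 : Set (Config D B)) (Φ : Config D A → Config D B) : Prop :=
  Set.MapsTo Φ 𝔄 𝔅 ∧ ContinuousOn Φ 𝔄 ∧
    ∀ v : Fin D → ℤ, ∀ a ∈ 𝔄, Φ (shift v a) = shift v (Φ a)

/-- `Φ` has radius `R` as a map on `𝔄`. -/
def HomHasRadius {B : Type} (𝔄 : Set (Config D A)) (Φ : Config D A → Config D B)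
    (R : ℕ) : Prop :=
  ∀ a ∈ 𝔄, ∀ a' ∈ 𝔄, ∀ z : Fin D → ℤ, blockAt R a z = blockAt R a' z → Φ a z = Φ a' z

/-! ### Dynamical cocycles (multiplicative) -/

/-- A continuous `G`-valued (dynamical) cocycle on `𝔄`. -/
def DynCocycleOn [TopologicalSpace A] {G : Type} [Group G] [TopologicalSpace G] (𝔄 : Set (Config D A))
    (C : (Fin D → ℤ) → Config D A → G) : Prop :=
  (∀ z : Fin D → ℤ, ContinuousOn (C z) 𝔄) ∧
    ∀ y z : Fin D → ℤ, ∀ a ∈ 𝔄, C (y + z) a = C y (shift z a) * C z a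

/-- Cohomologous cocycles, via a continuous transfer function. -/
def DynCohomologous [TopologicalSpace A] {G : Type} [Group G] [TopologicalSpace G] (𝔄 : Set (Config D A))
    (C C' : (Fin D → ℤ) → Config D A → G) : Prop :=
  ∃ b : Config D A → G, ContinuousOn b 𝔄 ∧
    ∀ z : Fin D → ℤ, ∀ a ∈ 𝔄, C' z a = b (shift z a) * C z a * (b a)⁻¹

/-- A trivial cocycle: cohomologous to a homomorphism `ℤ^D → G`. -/
def DynTrivial [TopologicalSpace A] {G : Type} [Group G] [TopologicalSpace G] (𝔄 : Set (Config D A))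
    (C : (Fin D → ℤ) → Config D A → G) : Prop :=
  ∃ h : (Fin D → ℤ) → G, (∀ y z : Fin D → ℤ, h (y + z) = h y * h z) ∧
    DynCohomologous 𝔄 C (fun z _ => h z)

/-- A cocycle is locally determined with radius `r` if `C(e, ·)` (for `e ∈ E`)
depends only on the `r`-block at `0`. -/
def LocallyDetermined {G : Type} [Group G] (𝔅 : Set (Config D A))
    (C : (Fin D → ℤ) → Config D A → G) (r : ℕ) : Prop :=
  ∀ e ∈ stdSteps D, ∀ b ∈ 𝔅, ∀ b' ∈ 𝔅,
    blockAt r b 0 = blockAt r b' 0 → C e b = C e b'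

/-- A fundamental cocycle: every continuous cocycle into a discrete group is
cohomologous to a homomorphic image of `Cstar`. -/
def IsFundamental [TopologicalSpace A] {Gs : Type} [Group Gs] [TopologicalSpace Gs] (𝔄 : Set (Config D A))
    (Cstar : (Fin D → ℤ) → Config D A → Gs) : Prop :=
  ∀ (H : Type) [Group H] [TopologicalSpace H] [DiscreteTopology H],
    ∀ C : (Fin D → ℤ) → Config D A → H,
      DynCocycleOn 𝔄 C → ∃ ψ : Gs →* H, DynCohomologous 𝔄 C fun z a => ψ (Cstar z a)


/-! ### Trails and locally determined cocycles via local rules -/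

/-- A trail: a nonempty sequence in `ℤ^D` whose successive steps lie in `E`. -/
def IsTrail (ζ : List (Fin D → ℤ)) : Prop :=
  ζ ≠ [] ∧ ζ.Chain' fun x y => y - x ∈ stdSteps D

/-- The trail `ζ` lies in `Y`. -/
def TrailIn (Y : Set (Fin D → ℤ)) (ζ : List (Fin D → ℤ)) : Prop := ∀ z ∈ ζ, z ∈ Y

/-- A closed trail: the first and last points coincide. -/
def IsClosedTrail (ζ : List (Fin D → ℤ)) : Prop := ζ.head? = ζ.getLast?

/-- Concatenation of trails (the final point of `ζ` should equal the initial
point of `ξ`). -/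
def trailConcat (ζ ξ : List (Fin D → ℤ)) : List (Fin D → ℤ) := ζ ++ ξ.tail

/-- The value `c(ζ, a)` of a local rule along a trail, later steps multiplied
on the left. -/
def trailVal {G : Type} [Group G] {r : ℕ} (c : (Fin D → ℤ) → (ballZ D r → A) → G)
    (a : Config D A) : List (Fin D → ℤ) → G
  | [] => 1
  | [_] => 1
  | x :: y :: rest => trailVal c a (y :: rest) * c (y - x) (blockAt r a x)

/-- A local rule of radius `r` for a `G`-valued cocycle on `𝔄`. -/
def IsLocalRule {G : Type} [Group G] (𝔄 : Set (Config D A)) (r : ℕ)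
    (c : (Fin D → ℤ) → (ballZ D r → A) → G) : Prop :=
  ∀ a : Config D A, ∀ e ∈ stdSteps D, ∀ e' ∈ stdSteps D,
    ((0 ∈ goodSet 𝔄 r a ∧ e ∈ goodSet 𝔄 r a ∧ e' ∈ goodSet 𝔄 r a ∧
        e + e' ∈ goodSet 𝔄 r a) →
      c e' (blockAt r a e) * c e (blockAt r a 0) =
        c e (blockAt r a e') * c e' (blockAt r a 0)) ∧
    ((0 ∈ goodSet 𝔄 r a ∧ e ∈ goodSet 𝔄 r a) →
      c (-e) (blockAt r a e) = (c e (blockAt r a 0))⁻¹)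

/-- Elementary `Y`-homotopies of trails. -/
inductive ElemHomotopy (Y : Set (Fin D → ℤ)) :
    List (Fin D → ℤ) → List (Fin D → ℤ) → Prop
  | slide (pre post : List (Fin D → ℤ)) (x y z : Fin D → ℤ)
      (hxy : y - x ∈ stdSteps D) (hyz : z - y ∈ stdSteps D) (hw : x + z - y ∈ Y) :
      ElemHomotopy Y (pre ++ x :: y :: z :: post) (pre ++ x :: (x + z - y) :: z :: post)
  | delBacktrack (pre post : List (Fin D → ℤ)) (x y : Fin D → ℤ)
      (hstep : y - x ∈ stdSteps D) :
      ElemHomotopy Y (pre ++ x :: y :: x :: post) (pre ++ x :: post)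
  | insBacktrack (pre post : List (Fin D → ℤ)) (x y : Fin D → ℤ)
      (hy : y ∈ Y) (hstep : y - x ∈ stdSteps D) :
      ElemHomotopy Y (pre ++ x :: post) (pre ++ x :: y :: x :: post)

/-- Two trails are `Y`-homotopic if joined by a finite chain of elementary
`Y`-homotopies. -/
def TrailHomotopic (Y : Set (Fin D → ℤ)) : List (Fin D → ℤ) → List (Fin D → ℤ) → Prop :=
  Relation.ReflTransGen fun p q => ElemHomotopy Y p q ∨ ElemHomotopy Y q p

/-- Points `z`, `y` joined by a trail lying in `Y`. -/
def TrailConnIn (Y : Set (Fin D → ℤ)) (z y : Fin D → ℤ) : Prop :=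
  ∃ (ζ : List (Fin D → ℤ)) (h : ζ ≠ []),
    IsTrail ζ ∧ TrailIn Y ζ ∧ ζ.head h = z ∧ ζ.getLast h = y

/-- `a` has a projective `c`-pole: for every `R ≥ r` there is a closed trail in
`G_R(a)` with nontrivial value. -/
def HasProjPole {G : Type} [Group G] (𝔄 : Set (Config D A)) (r : ℕ)
    (c : (Fin D → ℤ) → (ballZ D r → A) → G) (a : Config D A) : Prop :=
  ∀ R : ℕ, r ≤ R → ∃ ζ : List (Fin D → ℤ),
    IsTrail ζ ∧ IsClosedTrail ζ ∧ TrailIn (goodSet 𝔄 R a) ζ ∧ trailVal c a ζ ≠ 1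

/-- Restriction of a `ρ`-block to an `r`-block (`r ≤ ρ`). -/
def restrictBlock {r ρ : ℕ} (h : r ≤ ρ) (p : ballZ D ρ → A) : ballZ D r → A :=
  fun w => p ⟨w.1, by
    intro i
    exact le_trans (w.2 i) (by exact_mod_cast h)⟩

/-- The lift of a local rule of radius `r` to radius `ρ ≥ r`. -/
def liftRule {G : Type} [Group G] {r ρ : ℕ} (h : r ≤ ρ)
    (c : (Fin D → ℤ) → (ballZ D r → A) → G) :
    (Fin D → ℤ) → (ballZ D ρ → A) → G :=
  fun e p => c e (restrictBlock h p)

/-- Local rules of radius `ρ` are locally cohomologous via a local transfer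
function of some radius `s ≤ ρ`. -/
def LocallyCohomologous {G : Type} [Group G] (𝔄 : Set (Config D A)) (ρ : ℕ)
    (c₁ c₂ : (Fin D → ℤ) → (ballZ D ρ → A) → G) : Prop :=
  ∃ (s : ℕ) (_ : s ≤ ρ) (b : (ballZ D s → A) → G),
    ∀ a : Config D A, ∀ e ∈ stdSteps D,
      (0 ∈ goodSet 𝔄 ρ a ∧ e ∈ goodSet 𝔄 ρ a) →
      c₂ e (blockAt ρ a 0) = b (blockAt s a e) * c₁ e (blockAt ρ a 0) *
        (b (blockAt s a 0))⁻¹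

/-- Extend a block to a configuration (arbitrarily outside the block). -/
noncomputable def blockExtend [Nonempty A] {ρ : ℕ} (p : ballZ D ρ → A) : Config D A :=
  fun z => @dite A (z ∈ ballZ D ρ) (Classical.propDecidable _)
    (fun h => p ⟨z, h⟩) (fun _ => Classical.arbitrary A)

/-- The block map `Φ̄ : 𝔄_(r+R) → 𝔄_(r)` induced by a CA `Φ` of radius `R`. -/
noncomputable def blockMapCA [Nonempty A] (Φ : Config D A → Config D A) (R r : ℕ)
    (p : ballZ D (r + R) → A) : ballZ D r → A :=
  blockAt r (Φ (blockExtend p)) 0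

/-- The pullback local rule `Φ_* c` of radius `r + R`. -/
noncomputable def pullRule [Nonempty A] {G : Type} [Group G]
    (Φ : Config D A → Config D A) (R r : ℕ)
    (c : (Fin D → ℤ) → (ballZ D r → A) → G) :
    (Fin D → ℤ) → (ballZ D (r + R) → A) → G :=
  fun e p => c e (blockMapCA Φ R r p)

/-- Two local rules (of radii `r₁`, `r₂`) define the same class in
`H¹_loc(𝔄, G)`. -/
def SameHlocClass {G : Type} [CommGroup G] (𝔄 : Set (Config D A)) {r₁ r₂ : ℕ}
    (c₁ : (Fin D → ℤ) → (ballZ D r₁ → A) → G)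
    (c₂ : (Fin D → ℤ) → (ballZ D r₂ → A) → G) : Prop :=
  ∃ (ρ : ℕ) (h₁ : r₁ ≤ ρ) (h₂ : r₂ ≤ ρ) (h : (Fin D → ℤ) → G),
    (∀ y z : Fin D → ℤ, h (y + z) = h y * h z) ∧
    LocallyCohomologous 𝔄 ρ (liftRule h₁ c₁) fun e p => liftRule h₂ c₂ e p * h e

/-- `a` has a projective `G`-pole: a projective `c`-pole for some `G`-valued
local rule `c` of some radius. -/
def HasProjGPole (G : Type) [Group G] (𝔄 : Set (Config D A)) (a : Config D A) : Prop :=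
  ∃ (r : ℕ) (c : (Fin D → ℤ) → (ballZ D r → A) → G),
    IsLocalRule 𝔄 r c ∧ HasProjPole 𝔄 r c a

/-- A locally fundamental local rule (valued in a discrete abelian group). -/
def IsLocallyFundamental {Gs : Type} [CommGroup Gs] (𝔄 : Set (Config D A)) (rstar : ℕ)
    (cstar : (Fin D → ℤ) → (ballZ D rstar → A) → Gs) : Prop :=
  ∀ (H : Type) [CommGroup H], ∀ (r : ℕ) (c : (Fin D → ℤ) → (ballZ D r → A) → H),
    IsLocalRule 𝔄 r c →
    ∃ (ψ : Gs →* H) (ρ : ℕ) (h₁ : rstar ≤ ρ) (h₂ : r ≤ ρ),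
      LocallyCohomologous 𝔄 ρ (liftRule h₁ fun e p => ψ (cstar e p)) (liftRule h₂ c)

/-- A pseudonorm on `G`, with values in `[0, ∞]`. -/
def IsPseudonorm {G : Type} [Group G] (ν : G → ℝ≥0∞) : Prop :=
  ν 1 = 0 ∧ (∀ g h : G, ν (g * h) = ν (h * g)) ∧ ∀ g h : G, ν (g * h) ≤ ν g + ν h

/-- The `ℓ¹`-norm on `ℤ^D`. -/
def l1norm {D : ℕ} (v : Fin D → ℤ) : ℕ := ∑ i, (v i).natAbs


/-! ### Additive dynamical and equivariant cocycles -/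

/-- A continuous `(G,+)`-valued dynamical cocycle on `𝔄`. -/
def AddDynCocycleOn [TopologicalSpace A] {G : Type} [AddCommGroup G] [TopologicalSpace G]
    (𝔄 : Set (Config D A)) (C : (Fin D → ℤ) → Config D A → G) : Prop :=
  (∀ z : Fin D → ℤ, ContinuousOn (C z) 𝔄) ∧
    ∀ y z : Fin D → ℤ, ∀ a ∈ 𝔄, C (y + z) a = C y (shift z a) + C z a

/-- Cohomologous additive cocycles. -/
def AddDynCohomologous [TopologicalSpace A] {G : Type} [AddCommGroup G] [TopologicalSpace G]
    (𝔄 : Set (Config D A)) (C C' : (Fin D → ℤ) → Config D A → G) : Prop :=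
  ∃ b : Config D A → G, ContinuousOn b 𝔄 ∧
    ∀ z : Fin D → ℤ, ∀ a ∈ 𝔄, C' z a = b (shift z a) + C z a - b a

/-- The equivariant edge cocycle `Ψ(C̃)(x→y; a) = C̃(y−x, σ^x(a))` associated to a
dynamical cocycle. -/
def edgeCocycleOf {G : Type} [AddCommGroup G] (C : (Fin D → ℤ) → Config D A → G) :
    (Fin D → ℤ) → (Fin D → ℤ) → Config D A → G :=
  fun x y a => C (y - x) (shift x a)

/-- A continuous equivariant 1-cocycle on `𝔄` (as a function of oriented edges
`x → y`, i.e. pairs with `y - x ∈ E`). -/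
def IsEqCocycle [TopologicalSpace A] {G : Type} [AddCommGroup G] [TopologicalSpace G]
    (𝔄 : Set (Config D A)) (C : (Fin D → ℤ) → (Fin D → ℤ) → Config D A → G) : Prop :=
  (∀ x y : Fin D → ℤ, y - x ∈ stdSteps D → ContinuousOn (C x y) 𝔄) ∧
  (∀ x y z : Fin D → ℤ, y - x ∈ stdSteps D → ∀ a ∈ 𝔄,
      C x y (shift z a) = C (x + z) (y + z) a) ∧
  (∀ x y : Fin D → ℤ, y - x ∈ stdSteps D → ∀ a ∈ 𝔄, C y x a = -C x y a) ∧
  (∀ s : Fin D → ℤ, ∀ i j : Fin D, i ≠ j → ∀ a ∈ 𝔄,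
      C s (s + Pi.single i 1) a +
        C (s + Pi.single i 1) (s + Pi.single i 1 + Pi.single j 1) a =
      C s (s + Pi.single j 1) a +
        C (s + Pi.single j 1) (s + Pi.single i 1 + Pi.single j 1) a)

/-- Cohomologous equivariant 1-cocycles, via an equivariant continuous
0-cochain `B`. -/
def EqCohomologous [TopologicalSpace A] {G : Type} [AddCommGroup G] [TopologicalSpace G]
    (𝔄 : Set (Config D A)) (C C' : (Fin D → ℤ) → (Fin D → ℤ) → Config D A → G) : Prop :=
  ∃ B : (Fin D → ℤ) → Config D A → G,
    (∀ x : Fin D → ℤ, ContinuousOn (B x) 𝔄) ∧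
    (∀ x z : Fin D → ℤ, ∀ a ∈ 𝔄, B x (shift z a) = B (x + z) a) ∧
    ∀ x y : Fin D → ℤ, y - x ∈ stdSteps D → ∀ a ∈ 𝔄,
      C' x y a = B y a + C x y a - B x a

/-! ### Cells, chains, and equivariant `d`-cocycles -/

/-- A cell in `ℤ^D`: a base point together with a set of spanning directions. -/
abbrev Cell (D : ℕ) := (Fin D → ℤ) × Finset (Fin D)

/-- Chains: finitely supported `ℤ`-valued functions on cells. -/
abbrev CellChain (D : ℕ) := Cell D →₀ ℤ

/-- The boundary of a single cell. -/
noncomputable def cellBoundary {D : ℕ} (cell : Cell D) : CellChain D :=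
  ∑ i ∈ cell.2, ((-1 : ℤ) ^ (cell.2.filter fun j => j < i).card) •
    (Finsupp.single (cell.1 + Pi.single i 1, cell.2.erase i) (1 : ℤ) -
      Finsupp.single (cell.1, cell.2.erase i) (1 : ℤ))

/-- The boundary homomorphism on chains. -/
noncomputable def chainBoundary {D : ℕ} (ζ : CellChain D) : CellChain D :=
  ζ.sum fun cell n => n • cellBoundary cell

/-- The value of an equivariant cochain (of radius `r`) on a chain. -/
def chainVal {G : Type} [AddCommGroup G] {r : ℕ}
    (c : Finset (Fin D) → (ballZ D r → A) → G) (a : Config D A) (ζ : CellChain D) : G :=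
  ζ.sum fun cell n => n • c cell.2 (blockAt r a cell.1)

/-- An equivariant `d`-cocycle of radius `r` on `𝔄`: vanishes on boundaries of
`(d+1)`-cells over admissible configurations. -/
def IsEqDCocycle {G : Type} [AddCommGroup G] (𝔄 : Set (Config D A)) (d r : ℕ)
    (c : Finset (Fin D) → (ballZ D r → A) → G) : Prop :=
  ∀ a ∈ 𝔄, ∀ cell : Cell D, cell.2.card = d + 1 →
    chainVal c a (cellBoundary cell) = 0

/-- `a` has a projective `(G,d)`-pole. -/
def HasProjDPole (G : Type) [AddCommGroup G] (𝔄 : Set (Config D A)) (d : ℕ)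
    (a : Config D A) : Prop :=
  ∃ (r : ℕ) (c : Finset (Fin D) → (ballZ D r → A) → G),
    IsEqDCocycle 𝔄 d r c ∧
    ∀ R : ℕ, r ≤ R → ∃ ζ : CellChain D,
      (∀ cell ∈ ζ.support, (cell : Cell D).2.card = d) ∧
      chainBoundary ζ = 0 ∧
      (∀ cell ∈ ζ.support, (cell : Cell D).1 ∈ goodSet 𝔄 R a) ∧
      chainVal c a ζ ≠ 0


lemma blockAt_shift (r : ℕ) (a : Config D A) (v z : Fin D → ℤ) :
    blockAt r (shift v a) z = blockAt r a (z + v) := by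
  funext w
  simp only [blockAt, shift]
  congr 1
  abel

lemma blockAt_eq_of_le {r R : ℕ} (h : r ≤ R) {a b : Config D A} {x y : Fin D → ℤ}
    (hab : blockAt R a x = blockAt R b y) : blockAt r a x = blockAt r b y :=
  congrArg (restrictBlock h) hab

lemma blockAt_blockExtend [Nonempty A] {r : ℕ} (p : ballZ D r → A) :
    blockAt r (blockExtend p) 0 = p := by
  funext w
  simp [blockAt, blockExtend, w.2]

lemma mem_goodSet_shift (𝔄 : Set (Config D A)) (r : ℕ) (a : Config D A) (v z : Fin D → ℤ) :
    z ∈ goodSet 𝔄 r (shift v a) ↔ z + v ∈ goodSet 𝔄 r a := by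
  simp only [goodSet, Set.mem_ofPred_eq, blockAt_shift]

lemma goodSet_anti {𝔄 : Set (Config D A)} {r R : ℕ} (h : r ≤ R) (a : Config D A) :
    goodSet 𝔄 R a ⊆ goodSet 𝔄 r a := by
  rintro z ⟨a', ha', hz⟩
  exact ⟨a', ha', blockAt_eq_of_le h hz⟩

lemma IsSubshift.mem_goodSet [TopologicalSpace A] {𝔄 : Set (Config D A)} (h : IsSubshift 𝔄)
    {a : Config D A} (ha : a ∈ 𝔄) (r : ℕ) (z : Fin D → ℤ) : z ∈ goodSet 𝔄 r a := by
  refine ⟨shift z a, h.2.2 z ▸ Set.mem_image_of_mem _ ha, ?_⟩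
  simp only [blockAt_shift, zero_add]

/-- The `r`-block of `Φ a` at a point is determined by the `(r + R)`-block of `a` there. -/
lemma IsCellularAutomaton.blockAt_congr [TopologicalSpace A] {Φ : Config D A → Config D A}
    (hΦ : IsCellularAutomaton Φ) {R : ℕ} (hR : HasRadius Φ R) {r : ℕ} {a b : Config D A}
    {x y : Fin D → ℤ} (h : blockAt (r + R) a x = blockAt (r + R) b y) :
    blockAt r (Φ a) x = blockAt r (Φ b) y := by
  have key : ∀ (c : Config D A) (v : Fin D → ℤ), Φ (shift v c) = shift v (Φ c) :=
    fun c v => congrFun (hΦ.2 v) c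
  have hx : blockAt r (Φ a) x = blockAt r (Φ (shift x a)) 0 := by
    rw [key, blockAt_shift, zero_add]
  have hy : blockAt r (Φ b) y = blockAt r (Φ (shift y b)) 0 := by
    rw [key, blockAt_shift, zero_add]
  rw [hx, hy]
  funext w
  refine hR _ _ _ ?_
  rw [blockAt_shift, blockAt_shift]
  funext u
  have hmem : (w.1 + u.1) ∈ ballZ D (r + R) := by
    intro i
    have h1 := w.2 i
    have h2 := u.2 i
    have h3 := abs_add_le (w.1 i) (u.1 i)
    simp only [Pi.add_apply]
    push_cast
    linarith
  have hwu := congrFun h ⟨_, hmem⟩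
  simp only [blockAt] at hwu ⊢
  convert hwu using 2 <;> abel

lemma IsCellularAutomaton.blockMapCA_blockAt [TopologicalSpace A] [Nonempty A]
    {Φ : Config D A → Config D A} (hΦ : IsCellularAutomaton Φ) {R : ℕ} (hR : HasRadius Φ R)
    (r : ℕ) (a : Config D A) (x : Fin D → ℤ) :
    blockMapCA Φ R r (blockAt (r + R) a x) = blockAt r (Φ a) x :=
  hΦ.blockAt_congr hR (blockAt_blockExtend _)

lemma IsCellularAutomaton.goodSet_subset [TopologicalSpace A] {𝔄 : Set (Config D A)}
    {Φ : Config D A → Config D A} (hΦ : IsCellularAutomaton Φ) {R : ℕ} (hR : HasRadius Φ R)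
    (hinv : Φ '' 𝔄 ⊆ 𝔄) (r : ℕ) (a : Config D A) :
    goodSet 𝔄 (r + R) a ⊆ goodSet 𝔄 r (Φ a) := by
  rintro z ⟨a', ha', hz⟩
  exact ⟨Φ a', hinv ⟨a', ha', rfl⟩, hΦ.blockAt_congr hR hz⟩

lemma map_trailVal {G H : Type} [Group G] [Group H] (φ : G →* H) {r : ℕ}
    (c : (Fin D → ℤ) → (ballZ D r → A) → G) (a : Config D A) (ζ : List (Fin D → ℤ)) :
    φ (trailVal c a ζ) = trailVal (fun e p => φ (c e p)) a ζ := by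
  fun_induction trailVal c a ζ <;> simp_all [trailVal]

lemma IsClosedTrail.getLast_eq {x : Fin D → ℤ} {l : List (Fin D → ℤ)}
    (h : IsClosedTrail (x :: l)) : (x :: l).getLast (List.cons_ne_nil _ _) = x := by
  have hsome : some x = (x :: l).getLast? := h
  rw [List.getLast?_eq_some_getLast (List.cons_ne_nil _ _)] at hsome
  exact (Option.some.inj hsome).symm

/-- If two rules differ by a coboundary along the edges of `Y`, then their values along a trail in
`Y` differ by the values of the transfer function at the endpoints. -/
lemma trailVal_eq_of_coboundary {G : Type} [Group G] {r₁ r₂ : ℕ}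
    {c₁ : (Fin D → ℤ) → (ballZ D r₁ → A) → G} {c₂ : (Fin D → ℤ) → (ballZ D r₂ → A) → G}
    {a₁ a₂ : Config D A} {Y : Set (Fin D → ℤ)} (b : (Fin D → ℤ) → G)
    (h : ∀ x ∈ Y, ∀ y ∈ Y, y - x ∈ stdSteps D →
      c₂ (y - x) (blockAt r₂ a₂ x) = b y * c₁ (y - x) (blockAt r₁ a₁ x) * (b x)⁻¹)
    (x : Fin D → ℤ) (l : List (Fin D → ℤ)) (hl : IsTrail (x :: l)) (hY : TrailIn Y (x :: l)) :
    trailVal c₂ a₂ (x :: l) =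
      b ((x :: l).getLast (List.cons_ne_nil _ _)) * trailVal c₁ a₁ (x :: l) * (b x)⁻¹ := by
  induction l generalizing x with
  | nil => simp [trailVal]
  | cons y l ih =>
    have hc := List.isChain_cons_cons.1 hl.2
    rw [trailVal, trailVal, ih y ⟨by simp, hc.2⟩ fun z hz => hY z (List.mem_cons_of_mem _ hz),
      h x (hY x (by simp)) y (hY y (by simp)) hc.1, List.getLast_cons (List.cons_ne_nil _ _)]
    group

lemma exists_additive_of_commute {M : Type*} [Group M] (T : Fin D → M)
    (hT : ∀ i j, Commute (T i) (T j)) :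
    ∃ P : (Fin D → ℤ) → M, (∀ u v, P (u + v) = P u * P v) ∧ ∀ i, P (Pi.single i 1) = T i := by
  have hcomm : Pairwise fun i j : Fin D => ∀ x y : Multiplicative ℤ,
      Commute (zpowersHom M (T i) x) (zpowersHom M (T j) y) := fun i j _ x y => by
    simpa using (hT i j).zpow_zpow _ _
  let Q : (Fin D → Multiplicative ℤ) →* M :=
    MonoidHom.noncommPiCoprod (fun i => zpowersHom M (T i)) hcomm
  refine ⟨fun v => Q fun i => Multiplicative.ofAdd (v i), fun u v => ?_, fun i => ?_⟩
  · rw [← map_mul]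
    rfl
  · have : (fun j => Multiplicative.ofAdd ((Pi.single i 1 : Fin D → ℤ) j)) =
        Pi.mulSingle i (Multiplicative.ofAdd (1 : ℤ)) := by
      funext j
      by_cases hj : j = i
      · subst hj; simp
      · simp [hj]
    refine (congrArg Q this).trans ?_
    rw [MonoidHom.noncommPiCoprod_mulSingle]
    simp

lemma neg_mem_stdSteps {e : Fin D → ℤ} (he : e ∈ stdSteps D) : -e ∈ stdSteps D := by
  obtain ⟨i, rfl | rfl⟩ := he
  · exact ⟨i, Or.inr rfl⟩
  · exact ⟨i, Or.inl (neg_neg _)⟩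

/-- Over an admissible configuration a local rule takes trivial values along closed trails. -/
lemma IsLocalRule.trailVal_closed_eq_one [TopologicalSpace A] {G : Type} [Group G]
    {𝔄 : Set (Config D A)} (h𝔄 : IsSubshift 𝔄) {r : ℕ}
    {c : (Fin D → ℤ) → (ballZ D r → A) → G} (hc : IsLocalRule 𝔄 r c) {a : Config D A}
    (ha : a ∈ 𝔄) {ζ : List (Fin D → ℤ)} (hζ : IsTrail ζ) (hcl : IsClosedTrail ζ) :
    trailVal c a ζ = 1 := by
  let f : (Fin D → ℤ) → (Fin D → ℤ) → G := fun e x => c e (blockAt r a x)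
  have hgood : ∀ x z, z ∈ goodSet 𝔄 r (shift x a) := fun x z =>
    (mem_goodSet_shift 𝔄 r a x z).2 (h𝔄.mem_goodSet ha r _)
  have hsq : ∀ x, ∀ e ∈ stdSteps D, ∀ e' ∈ stdSteps D,
      f e' (x + e) * f e x = f e (x + e') * f e' x := by
    intro x e he e' he'
    have := (hc (shift x a) e he e' he').1 ⟨hgood _ _, hgood _ _, hgood _ _, hgood _ _⟩
    simpa [blockAt_shift, f, add_comm] using this
  have hinv : ∀ x, ∀ e ∈ stdSteps D, f (-e) (x + e) = (f e x)⁻¹ := by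
    intro x e he
    have := (hc (shift x a) e he e he).2 ⟨hgood _ _, hgood _ _⟩
    simpa [blockAt_shift, f, add_comm] using this
  have hstd : ∀ i : Fin D, (Pi.single i 1 : Fin D → ℤ) ∈ stdSteps D := fun i => ⟨i, Or.inl rfl⟩
  -- parallel transport along `e_i` on the total space `ℤ^D × G`
  let T : Fin D → Equiv.Perm ((Fin D → ℤ) × G) := fun i =>
    { toFun := fun p => (p.1 + Pi.single i 1, f (Pi.single i 1) p.1 * p.2)
      invFun := fun p => (p.1 + -Pi.single i 1, f (-Pi.single i 1) p.1 * p.2)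
      left_inv := fun p => by
        ext1
        · simp
        · simp [hinv p.1 _ (hstd i)]
      right_inv := fun p => by
        ext1
        · simp
        · have := hinv p.1 _ (neg_mem_stdSteps (hstd i))
          rw [neg_neg] at this
          simp [this] }
  obtain ⟨P, hadd, hP⟩ := exists_additive_of_commute T fun i j => by
    refine Equiv.ext fun p => Prod.ext ?_ ?_
    · simp only [T, Equiv.Perm.mul_apply, Equiv.coe_fn_mk]
      abel
    · simp only [T, Equiv.Perm.mul_apply, Equiv.coe_fn_mk, ← mul_assoc]
      rw [hsq _ _ (hstd i) _ (hstd j)]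
  have hP0 : P 0 = 1 := by simpa using hadd 0 0
  have hstep : ∀ e ∈ stdSteps D, ∀ x g, P e (x, g) = (x + e, f e x * g) := by
    rintro e ⟨i, rfl | rfl⟩ x g
    · rw [hP]
      rfl
    · have : P (-Pi.single i 1) = (T i)⁻¹ := by
        rw [eq_inv_iff_mul_eq_one, ← hP, ← hadd, neg_add_cancel, hP0]
      rw [this]
      rfl
  have htrail : ∀ (l : List (Fin D → ℤ)) (x : Fin D → ℤ) (g : G), IsTrail (x :: l) →
      P ((x :: l).getLast (List.cons_ne_nil _ _) - x) (x, g) =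
        ((x :: l).getLast (List.cons_ne_nil _ _), trailVal c a (x :: l) * g) := by
    intro l
    induction l with
    | nil => simp [trailVal, hP0]
    | cons y l ih =>
      intro x g hl
      have hch := List.isChain_cons_cons.1 hl.2
      rw [List.getLast_cons (List.cons_ne_nil _ _), ← sub_add_sub_cancel _ y x, hadd,
        Equiv.Perm.mul_apply, hstep _ hch.1, add_sub_cancel, ih y _ ⟨by simp, hch.2⟩,
        trailVal, mul_assoc]
  obtain _ | ⟨x, l⟩ := ζ
  · rfl
  · have := htrail l x 1 hζ
    rw [hcl.getLast_eq, sub_self, hP0, mul_one] at this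
    exact (congrArg Prod.snd this).symm

theorem statement_13 {D : ℕ} (hD : 1 ≤ D) {A : Type} [Fintype A] [Nonempty A]
    [TopologicalSpace A] [DiscreteTopology A]
    (𝔄 : Set (Config D A)) (h𝔄 : IsSubshift 𝔄)
    {Gs : Type} [CommGroup Gs] (rstar : ℕ)
    (cstar : (Fin D → ℤ) → (ballZ D rstar → A) → Gs)
    (hstar : IsLocalRule 𝔄 rstar cstar)
    (Φ : Config D A → Config D A) (hΦ : IsCellularAutomaton Φ)
    (R : ℕ) (hR : HasRadius Φ R) (hinv : Φ '' 𝔄 ⊆ 𝔄)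
    (φ : Gs →* Gs)
    (ρ : ℕ) (h₁ : rstar + R ≤ ρ) (h₂ : rstar ≤ ρ)
    (hcoh : LocallyCohomologous 𝔄 ρ (liftRule h₁ (pullRule Φ R rstar cstar))
        (liftRule h₂ fun e p => φ (cstar e p))) :
    -- (i)
    (∀ (a : Config D A) (ζ : List (Fin D → ℤ)), IsTrail ζ → IsClosedTrail ζ →
        TrailIn (goodSet 𝔄 ρ a) ζ →
        trailVal cstar (Φ a) ζ = φ (trailVal cstar a ζ)) ∧
    -- (ii)
    (Function.Injective φ →
      (∀ a ∈ almostAdmissible 𝔄, HasProjPole 𝔄 rstar cstar a →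
          HasProjPole 𝔄 rstar cstar (Φ a)) ∧
      ∀ a ∈ almostAdmissible 𝔄, HasProjPole 𝔄 rstar cstar a →
        ∀ t : ℕ, Φ^[t] a ∉ 𝔄) := by
  have hval : ∀ (a : Config D A) (ζ : List (Fin D → ℤ)), IsTrail ζ → IsClosedTrail ζ →
      TrailIn (goodSet 𝔄 ρ a) ζ → trailVal cstar (Φ a) ζ = φ (trailVal cstar a ζ) := by
    obtain ⟨s, -, b, hb⟩ := hcoh
    intro a ζ hζ hcl hin
    obtain _ | ⟨x, l⟩ := ζ
    · exact absurd rfl hζ.1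
    have htransfer := trailVal_eq_of_coboundary (c₁ := cstar) (c₂ := fun e p => φ (cstar e p))
      (a₁ := Φ a) (a₂ := a) (Y := goodSet 𝔄 ρ a) (fun z => b (blockAt s a z)) ?_ x l hζ hin
    · rw [map_trailVal, htransfer, hcl.getLast_eq, mul_inv_cancel_comm]
    intro x hx y hy hxy
    have := hb (shift x a) (y - x) hxy
      ⟨by rwa [mem_goodSet_shift, zero_add], by rwa [mem_goodSet_shift, sub_add_cancel]⟩
    rw [blockAt_shift, blockAt_shift, blockAt_shift, zero_add, sub_add_cancel] at this
    rw [← hΦ.blockMapCA_blockAt hR]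
    exact this
  refine ⟨hval, fun hφ => ?_⟩
  have hpole : ∀ a, HasProjPole 𝔄 rstar cstar a → HasProjPole 𝔄 rstar cstar (Φ a) := by
    intro a ha r hr
    obtain ⟨ζ, hζ, hcl, hin, hne⟩ := ha (max ρ (r + R)) (h₂.trans (le_max_left _ _))
    refine ⟨ζ, hζ, hcl, fun z hz => hΦ.goodSet_subset hR hinv r a
      (goodSet_anti (le_max_right _ _) a (hin z hz)), ?_⟩
    rw [hval a ζ hζ hcl fun z hz => goodSet_anti (le_max_left _ _) a (hin z hz)]
    exact (map_ne_one_iff φ hφ).2 hne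
  refine ⟨fun a _ => hpole a, fun a _ ha t hmem => ?_⟩
  have hiter : HasProjPole 𝔄 rstar cstar (Φ^[t] a) :=
    Function.Iterate.rec (HasProjPole 𝔄 rstar cstar) ha hpole t
  obtain ⟨ζ, hζ, hcl, -, hne⟩ := hiter rstar le_rfl
  exact hne (hstar.trailVal_closed_eq_one h𝔄 hmem hζ hcl)

end Defects
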